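/- Define m_n = 2·(2n)!·3^n/((n+2)!·n!) for nonnegative integers n (by Tutte's formula, this is the number of rooted planar maps with n edges). Then there exists a constant C > 0 such that for all integers n ≥ 2 and all integers k with 1 ≤ k ≤ n/2: |12^k · m_{n−k}/m_n − 1 − 5k/(2n)| ≤ C · (k/n)². Equivalently, m_{n−k}/m_n = (1 + 5k/(2n) + O((k/n)²)) · 12^{−k} uniformly in this range. -/

import Mathlib

noncomputable section

/-- Tutte's formula: the number `m_n = 2·(2n)!·3^n/((n+2)!·n!)` of rooted planar maps with
`n` edges, as a real number. -/
def tutteCount (n : ℕ) : ℝ :=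
  2 * ((2 * n).factorial : ℝ) * 3 ^ n / (((n + 2).factorial : ℝ) * (n.factorial : ℝ))

theorem tutteCount_pos (n : ℕ) : 0 < tutteCount n := by
  unfold tutteCount
  positivity

theorem tutteCount_succ (n : ℕ) :
    tutteCount (n + 1) * (n + 3) = 6 * (2 * n + 1) * tutteCount n := by
  unfold tutteCount
  rw [show 2 * (n + 1) = 2 * n + 1 + 1 by ring, show n + 1 + 2 = n + 2 + 1 by ring,
    Nat.factorial_succ (2 * n + 1), Nat.factorial_succ (2 * n), Nat.factorial_succ (n + 2),
    Nat.factorial_succ n]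
  push_cast
  field_simp
  ring

/-- Going down by one index multiplies the normalized count by `1 + 5 / (2j + 1)`. -/
theorem twelve_mul_tutteCount (j : ℕ) :
    12 * tutteCount j = tutteCount (j + 1) * (1 + 5 / (2 * j + 1)) := by
  have h := tutteCount_succ j
  field_simp
  linarith

theorem tutteCount_ratio_succ {n k : ℕ} (hk : k < n) :
    (12 : ℝ) ^ (k + 1) * tutteCount (n - (k + 1)) / tutteCount n
      = (12 : ℝ) ^ k * tutteCount (n - k) / tutteCount n * (1 + 5 / (2 * ((n : ℝ) - k) - 1)) := by
  obtain ⟨j, rfl⟩ := Nat.exists_eq_add_of_lt hk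
  have h := twelve_mul_tutteCount j
  rw [show k + j + 1 - (k + 1) = j by omega, show k + j + 1 - k = j + 1 by omega, pow_succ,
    mul_assoc, h]
  push_cast
  rw [show 2 * ((k : ℝ) + j + 1 - k) - 1 = 2 * j + 1 by ring]
  ring

/-- Lower bound, two crude upper bounds, and the sharp upper bound for the normalized ratio,
proved by simultaneous induction on `k`. -/
theorem tutteCount_ratio_bounds {n : ℕ} (hn : 0 < n) (k : ℕ) (hk : 2 * k ≤ n) :
    1 + 5 / 2 * (k / n : ℝ) ≤ (12 : ℝ) ^ k * tutteCount (n - k) / tutteCount n ∧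
    (12 : ℝ) ^ k * tutteCount (n - k) / tutteCount n ≤ Real.exp (5 * (k / n)) ∧
    (12 : ℝ) ^ k * tutteCount (n - k) / tutteCount n ≤ 1 + 5 * Real.exp 3 * (k / n) ∧
    (12 : ℝ) ^ k * tutteCount (n - k) / tutteCount n
      ≤ 1 + 5 / 2 * (k / n) + (5 / 2 + 13 * Real.exp 3) * (k / n) ^ 2 := by
  induction k with
  | zero => simp [(tutteCount_pos n).ne']
  | succ k ih =>
    obtain ⟨h1, h2, h3, h4⟩ := ih (by omega)
    rw [tutteCount_ratio_succ (by omega)]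
    set R := (12 : ℝ) ^ k * tutteCount (n - k) / tutteCount n
    set M := Real.exp 3
    have hM : 0 < M := Real.exp_pos 3
    have hn' : (0 : ℝ) < n := by exact_mod_cast hn
    have hk' : 2 * ((k : ℝ) + 1) ≤ n := by exact_mod_cast hk
    have hk0 : (0 : ℝ) ≤ k := k.cast_nonneg
    have hd : (n : ℝ) ≤ 2 * ((n : ℝ) - k) - 1 := by linarith
    have hd0 : 0 < 2 * ((n : ℝ) - k) - 1 := hn'.trans_le hd
    have he_upper : 5 / (2 * ((n : ℝ) - k) - 1) ≤ 5 / n := by gcongr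
    have he_lower : 5 / (2 * n) ≤ 5 / (2 * ((n : ℝ) - k) - 1) := by
      gcongr
      linarith
    have he_sharp : 5 / (2 * ((n : ℝ) - k) - 1) ≤
        5 / (2 * n) + 5 * (2 * k + 1) / (2 * (n * n)) := by
      have : 5 / (2 * ((n : ℝ) - k) - 1)
          = 5 / (2 * n) + 5 * (2 * k + 1) / (2 * (n * (2 * ((n : ℝ) - k) - 1))) := by
        field_simp
        ring
      rw [this]
      gcongr
    set e := 5 / (2 * ((n : ℝ) - k) - 1)
    obtain ⟨u, hu⟩ : ∃ u : ℝ, u = 1 / n := ⟨_, rfl⟩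
    have hu0 : 0 < u := by rw [hu]; positivity
    have hku : (k : ℝ) / n = k * u := by rw [hu]; ring
    have hku' : ((k + 1 : ℕ) : ℝ) / n = (k + 1) * u := by rw [hu]; push_cast; ring
    rw [show 5 / (n : ℝ) = 5 * u by rw [hu]; ring] at he_upper
    rw [show 5 / (2 * (n : ℝ)) = 5 / 2 * u by rw [hu]; ring] at he_lower he_sharp
    rw [show 5 * (2 * (k : ℝ) + 1) / (2 * (n * n)) = 5 / 2 * (2 * k + 1) * u ^ 2 by
      rw [hu]; field_simp] at he_sharp
    rw [hku] at h1 h2 h3 h4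
    rw [hku']
    have hkun : k * u ≤ 1 / 2 := by
      rw [← hku, div_le_iff₀ hn']
      linarith
    have hku0 : 0 ≤ k * u := by positivity
    have he0 : 0 ≤ e := by positivity
    have hR1 : 1 ≤ R := by linarith
    have hRM : R ≤ M := h2.trans (Real.exp_le_exp.mpr (by linarith))
    refine ⟨?_, ?_, ?_, ?_⟩
    · nlinarith [mul_le_mul_of_nonneg_right hR1 he0]
    · calc R * (1 + e) ≤ Real.exp (5 * (k * u)) * Real.exp (5 * u) := by
            gcongr
            linarith [Real.add_one_le_exp (5 * u)]
        _ = Real.exp (5 * ((k + 1) * u)) := by rw [← Real.exp_add]; ring_nf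
    · have : R * e ≤ M * (5 * u) := by gcongr
      linarith
    · have hRe : (R - 1) * e ≤ 5 * M * (k * u) * (5 * u) := by
        gcongr
        linarith
      have : 0 ≤ M * (k * u ^ 2) := by positivity
      have : 0 ≤ M * u ^ 2 := by positivity
      linarith

/-- Uniformly for `1 ≤ k ≤ n/2`, the ratio of numbers of rooted planar maps satisfies
`m_{n−k}/m_n = (1 + 5k/(2n) + O((k/n)²)) · 12^{−k}`; equivalently,
`|12^k · m_{n−k}/m_n − 1 − 5k/(2n)| ≤ C (k/n)²` for an absolute constant `C`. -/
theorem tutteCount_ratio_asymp :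
    ∃ C : ℝ, 0 < C ∧ ∀ n : ℕ, 2 ≤ n → ∀ k : ℕ, 1 ≤ k → 2 * k ≤ n →
      |(12 : ℝ) ^ k * tutteCount (n - k) / tutteCount n - 1 - 5 * k / (2 * n)|
        ≤ C * ((k : ℝ) / n) ^ 2 := by
  refine ⟨5 / 2 + 13 * Real.exp 3, by positivity, fun n hn k _ hk => ?_⟩
  obtain ⟨h1, _, _, h4⟩ := tutteCount_ratio_bounds (by omega : 0 < n) k hk
  rw [show 5 * (k : ℝ) / (2 * n) = 5 / 2 * (k / n) by ring, abs_of_nonneg (by linarith)]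
  linarith
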